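/- Let α be a finite type with N elements, let k and n be integers with 1 ≤ k ≤ n ≤ N, and set m = ⌊n/k⌋. Let H be a nonempty class of {0,1}-valued hypotheses f : Finset α → ℝ whose VC dimension (with respect to size-k subsets of α) equals d, where 1 ≤ d ≤ m. If C is a uniformly random size-n subset of α, then for every real ε with 0 < ε ≤ 1: P[ sup_{f ∈ H} | Q_k(Finset.univ, f) − Q_k(C, f) | ≥ ε ] ≤ exp(− m ε² / 4) + ε · √(8 π m) · (2 e m / d)^d · exp(− m ε² / 8). -/

import Mathlib

open scoped Classical

/-- The average of `f` over all size-`k` subsets of `C`: the probability `Q_{Υ,k}(f)` that a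
uniformly random size-`k` fragment of the relational example with domain `C` satisfies `f`. -/
noncomputable def Qk {α : Type*} [DecidableEq α] (k : ℕ) (C : Finset α) (f : Finset α → ℝ) : ℝ :=
  ((C.card.choose k : ℝ))⁻¹ * ∑ S ∈ C.powersetCard k, f S

/-- `H` shatters the collection `X` of size-`k` subsets of `α`: every `S ∈ X` has cardinality `k`,
and for every `Y ⊆ X` there is `f ∈ H` taking value `1` on `Y` and `0` on `X \ Y`. -/
def Shatters {α : Type*} [DecidableEq α] (k : ℕ)
    (H : Set (Finset α → ℝ)) (X : Finset (Finset α)) : Prop :=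
  (∀ S ∈ X, S.card = k) ∧
    ∀ Y ⊆ X, ∃ f ∈ H, (∀ S ∈ Y, f S = 1) ∧ ∀ S ∈ X \ Y, f S = 0

/-- The VC dimension of `H` with respect to size-`k` subsets of `α` equals `d`: `d` is the largest
cardinality of a collection of size-`k` subsets shattered by `H`. -/
def VCDimEq {α : Type*} [DecidableEq α] (k : ℕ) (H : Set (Finset α → ℝ)) (d : ℕ) : Prop :=
  IsGreatest {m : ℕ | ∃ X : Finset (Finset α), Shatters k H X ∧ X.card = m} d

theorem exists_perm_map_eq {α : Type*} [Fintype α] [DecidableEq α] {T C T' C' : Finset α}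
    (hT : T ⊆ C) (hT' : T' ⊆ C') (hTT' : T.card = T'.card) (hCC' : C.card = C'.card) :
    ∃ π : Equiv.Perm α, T.map π.toEmbedding = T' ∧ C.map π.toEmbedding = C' := by
  have hfib : ∀ c : Bool × Bool,
      Nonempty ({a // (decide (a ∈ T), decide (a ∈ C)) = c} ≃
        {a // (decide (a ∈ T'), decide (a ∈ C')) = c}) := by
    have hfilter : ∀ {T C : Finset α}, T ⊆ C → ∀ c : Bool × Bool,
        Fintype.card {a // (decide (a ∈ T), decide (a ∈ C)) = c} =
          match c with
          | (true, true) => T.card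
          | (true, false) => 0
          | (false, true) => C.card - T.card
          | (false, false) => Fintype.card α - C.card := by
      intro T C h c
      rw [Fintype.card_subtype]
      rcases c with ⟨_ | _, _ | _⟩
      · rw [← Finset.card_compl]
        congr 1
        ext a
        simpa using fun h1 h2 => h1 (h h2)
      · rw [← Finset.card_sdiff_of_subset h]
        congr 1
        ext a
        simp [and_comm]
      · simpa using fun a h1 => h h1
      · congr 1
        ext a
        simpa using fun h1 => h h1
    intro c
    refine ⟨Fintype.equivOfCardEq ?_⟩
    rw [hfilter hT, hfilter hT', hTT', hCC']
  let π : Equiv.Perm α := Equiv.ofFiberEquiv fun c => (hfib c).some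
  have hπ : ∀ a, (decide (π a ∈ T'), decide (π a ∈ C')) = (decide (a ∈ T), decide (a ∈ C)) :=
    fun a => Equiv.ofFiberEquiv_map (g := fun a => (decide (a ∈ T'), decide (a ∈ C'))) _ a
  simp only [Prod.mk.injEq, decide_eq_decide] at hπ
  refine ⟨π, ?_, ?_⟩
  · ext a
    rw [Finset.mem_map_equiv, ← (hπ _).1, Equiv.apply_symm_apply]
  · ext a
    rw [Finset.mem_map_equiv, ← (hπ _).2, Equiv.apply_symm_apply]

theorem sum_choose_le_exp_mul_div_pow {M d : ℕ} (hd : 1 ≤ d) (hdM : d ≤ M) :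
    (∑ i ∈ Finset.Iic d, (M.choose i : ℝ)) ≤ (Real.exp 1 * M / d) ^ d := by
  have hd0 : (0 : ℝ) < d := by exact_mod_cast hd
  have hM0 : (0 : ℝ) < M := by exact_mod_cast hd.trans hdM
  set r : ℝ := d / M with hr
  have hr0 : 0 < r := by positivity
  have hr1 : r ≤ 1 := (div_le_one hM0).2 (by exact_mod_cast hdM)
  have key : (∑ i ∈ Finset.Iic d, (M.choose i : ℝ)) * r ^ d ≤ Real.exp 1 ^ d := by
    calc (∑ i ∈ Finset.Iic d, (M.choose i : ℝ)) * r ^ d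
        ≤ ∑ i ∈ Finset.Iic d, r ^ i * (M.choose i : ℝ) := by
          rw [Finset.sum_mul]
          refine Finset.sum_le_sum fun i hi => ?_
          rw [mul_comm]
          gcongr ?_ * _
          exact pow_le_pow_of_le_one hr0.le hr1 (Finset.mem_Iic.1 hi)
      _ ≤ ∑ i ∈ Finset.range (M + 1), r ^ i * (M.choose i : ℝ) := by
          refine Finset.sum_le_sum_of_subset_of_nonneg (fun i hi => ?_) fun i _ _ => by positivity
          rw [Finset.mem_Iic] at hi
          rw [Finset.mem_range]
          omega
      _ = (r + 1) ^ M := by simp [add_pow]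
      _ ≤ Real.exp r ^ M := by
          gcongr
          exact Real.add_one_le_exp r
      _ = Real.exp 1 ^ d := by
          rw [← Real.exp_nat_mul, ← Real.exp_nat_mul, hr]
          congr 1
          field_simp
  rw [← le_div_iff₀ (by positivity), ← div_pow] at key
  refine key.trans_eq ?_
  rw [hr]
  congr 1
  field_simp

theorem card_image_comp_le {κ β : Type*} [Fintype κ] [DecidableEq κ] [DecidableEq β]
    {F : Finset (β → ℝ)} {d : ℕ}
    (hF : ∀ f ∈ F, ∀ b, f b = 0 ∨ f b = 1)
    (hVC : ∀ X : Finset β, (∀ Y ⊆ X, ∃ f ∈ F, (∀ b ∈ Y, f b = 1) ∧ ∀ b ∈ X \ Y, f b = 0) →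
      X.card ≤ d) (Z : κ → β) :
    (F.image fun f => f ∘ Z).card ≤ ∑ i ∈ Finset.Iic d, (Fintype.card κ).choose i := by
  set A : Finset (Finset κ) := F.image fun f => Finset.univ.filter fun j => f (Z j) = 1 with hA
  have hcard : (F.image fun f => f ∘ Z).card ≤ A.card := by
    refine Finset.card_le_card_of_injOn (fun v => Finset.univ.filter fun j => v j = 1) ?_ ?_
    · intro v hv
      simp only [Finset.coe_image, Set.mem_image, Finset.mem_coe] at hv
      obtain ⟨f, hf, rfl⟩ := hv
      exact Finset.mem_coe.2 (Finset.mem_image.2 ⟨f, hf, rfl⟩)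
    · intro v hv w hw hvw
      simp only [Finset.coe_image, Set.mem_image, Finset.mem_coe] at hv hw
      obtain ⟨f, hf, rfl⟩ := hv
      obtain ⟨g, hg, rfl⟩ := hw
      ext j
      have := Finset.ext_iff.1 hvw j
      simp only [Finset.mem_filter, Finset.mem_univ, true_and, Function.comp_apply] at this ⊢
      rcases hF f hf (Z j) with h | h <;> rcases hF g hg (Z j) with h' | h' <;> simp_all
  have hdim : A.vcDim ≤ d := by
    refine Finset.sup_le fun J hJ => ?_
    rw [Finset.mem_shatterer] at hJ
    have htrace : ∀ L ⊆ J, ∃ f ∈ F, ∀ j ∈ J, f (Z j) = 1 ↔ j ∈ L := by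
      intro L hL
      obtain ⟨u, hu, hJu⟩ := hJ hL
      obtain ⟨f, hf, rfl⟩ := Finset.mem_image.1 hu
      refine ⟨f, hf, fun j hj => ?_⟩
      rw [← hJu]
      simp [hj]
    have hinj : Set.InjOn Z J := by
      intro i hi j hj hij
      obtain ⟨f, -, hfL⟩ := htrace {i} (Finset.singleton_subset_iff.2 hi)
      have h1 := (hfL i hi).2 (Finset.mem_singleton_self i)
      rw [hij] at h1
      exact (Finset.mem_singleton.1 ((hfL j hj).1 h1)).symm
    rw [← Finset.card_image_of_injOn hinj]
    refine hVC _ fun Y hY => ?_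
    obtain ⟨f, hf, hfL⟩ := htrace (J.filter fun j => Z j ∈ Y) (Finset.filter_subset _ _)
    refine ⟨f, hf, fun b hb => ?_, fun b hb => ?_⟩
    · obtain ⟨j, hj, rfl⟩ := Finset.mem_image.1 (hY hb)
      exact (hfL j hj).2 (Finset.mem_filter.2 ⟨hj, hb⟩)
    · obtain ⟨hb1, hb2⟩ := Finset.mem_sdiff.1 hb
      obtain ⟨j, hj, rfl⟩ := Finset.mem_image.1 hb1
      refine (hF f hf (Z j)).resolve_right fun h => hb2 ?_
      exact (Finset.mem_filter.1 ((hfL j hj).1 h)).2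
  calc _ ≤ A.card := hcard
    _ ≤ A.shatterer.card := Finset.card_le_card_shatterer A
    _ ≤ ∑ i ∈ Finset.Iic A.vcDim, (Fintype.card κ).choose i := Finset.card_shatterer_le_sum_vcDim
    _ ≤ _ := Finset.sum_le_sum_of_subset (Finset.Iic_subset_Iic.2 hdim)

theorem sum_exp_sign_le {ι : Type*} [Fintype ι] [DecidableEq ι] (c : ℝ) {a : ι → ℝ}
    (ha : ∀ i, |a i| ≤ 1) :
    ∑ σ : ι → Bool, Real.exp (c * ∑ i, (if σ i then -a i else a i)) ≤
      2 ^ Fintype.card ι * Real.exp (c ^ 2 * Fintype.card ι / 2) := by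
  calc ∑ σ : ι → Bool, Real.exp (c * ∑ i, (if σ i then -a i else a i))
      = ∑ σ : ι → Bool, ∏ i, Real.exp (c * (if σ i then -a i else a i)) := by
        simp_rw [Finset.mul_sum, Real.exp_sum]
    _ = ∏ i, ∑ b : Bool, Real.exp (c * (if b then -a i else a i)) :=
        (Fintype.prod_sum fun i (b : Bool) => Real.exp (c * (if b then -a i else a i))).symm
    _ ≤ ∏ _i : ι, 2 * Real.exp (c ^ 2 / 2) := by
        refine Finset.prod_le_prod (fun i _ => by positivity) fun i _ => ?_
        have h1 : ∑ b : Bool, Real.exp (c * (if b then -a i else a i)) =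
            2 * Real.cosh (c * a i) := by
          rw [Real.cosh_eq]
          simp
          ring
        rw [h1]
        gcongr
        refine (Real.cosh_le_exp_half_sq _).trans (Real.exp_le_exp.2 ?_)
        have h2 : a i ^ 2 ≤ 1 := (sq_le_one_iff_abs_le_one _).2 (ha i)
        have h3 := mul_le_mul_of_nonneg_left h2 (sq_nonneg c)
        rw [mul_pow]
        linarith
    _ = _ := by
        rw [Finset.prod_const, mul_pow, ← Real.exp_nat_mul, Finset.card_univ]
        congr 2
        ring

/-- The involution of `ι × Bool` exchanging `(i, true)` and `(i, false)` whenever `σ i` holds. -/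
def swapPerm {ι : Type*} (σ : ι → Bool) : Equiv.Perm (ι × Bool) :=
  Function.Involutive.toPerm (fun j => (j.1, xor (σ j.1) j.2)) fun j => by simp

theorem swapPerm_apply {ι : Type*} (σ : ι → Bool) (j : ι × Bool) :
    swapPerm σ j = (j.1, xor (σ j.1) j.2) := rfl

theorem sum_image_exp_le {ι K : Type*} [Fintype ι] [DecidableEq ι] [Fintype K]
    {F : Finset (K → ℝ)} (hF : ∀ f ∈ F, ∀ b, f b = 0 ∨ f b = 1) {P : ℝ}
    (hP : ∀ Z : ι × Bool → K, ((F.image fun f => f ∘ Z).card : ℝ) ≤ P) (c : ℝ) :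
    ∑ Z : ι × Bool → K, ∑ v ∈ F.image fun f => f ∘ Z,
        Real.exp (c * ∑ i, (v (i, true) - v (i, false))) ≤
      Fintype.card (ι × Bool → K) * (P * Real.exp (c ^ 2 * Fintype.card ι / 2)) := by
  set φ : (ι × Bool → ℝ) → ℝ := fun v => Real.exp (c * ∑ i, (v (i, true) - v (i, false))) with hφ
  set G : (ι × Bool → K) → ℝ := fun Z => ∑ v ∈ F.image fun f => f ∘ Z, φ v with hG
  set R : ℝ := Real.exp (c ^ 2 * Fintype.card ι / 2) with hR
  have hswap : ∀ σ : ι → Bool,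
      ∑ Z, G Z = ∑ Z, ∑ v ∈ F.image fun f => f ∘ Z, φ (v ∘ swapPerm σ) := by
    intro σ
    rw [← ((swapPerm σ).arrowCongr (Equiv.refl K)).symm.sum_comp]
    refine Finset.sum_congr rfl fun Z _ => ?_
    have himage : (F.image fun f => f ∘ ((swapPerm σ).arrowCongr (Equiv.refl K)).symm Z) =
        (F.image fun f => f ∘ Z).image fun v => v ∘ swapPerm σ := by
      rw [Finset.image_image]
      rfl
    simp only [hG]
    rw [himage, Finset.sum_image]
    exact fun v _ w _ h => (swapPerm σ).surjective.injective_comp_right h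
  have hv : ∀ Z, ∀ v ∈ F.image fun f => f ∘ Z,
      ∑ σ : ι → Bool, φ (v ∘ swapPerm σ) ≤ 2 ^ Fintype.card ι * R := by
    intro Z v hv
    obtain ⟨f, hf, rfl⟩ := Finset.mem_image.1 hv
    refine le_of_eq_of_le (Finset.sum_congr rfl fun σ _ => ?_)
      (sum_exp_sign_le c (a := fun i => f (Z (i, true)) - f (Z (i, false))) fun i => ?_)
    · simp only [hφ]
      congr 2
      refine Finset.sum_congr rfl fun i _ => ?_
      cases h : σ i <;> simp [swapPerm_apply, h]
    · rcases hF f hf (Z (i, true)) with h | h <;> rcases hF f hf (Z (i, false)) with h' | h' <;>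
        simp [h, h']
  have key : (2 : ℝ) ^ Fintype.card ι * ∑ Z, G Z ≤
      2 ^ Fintype.card ι * (Fintype.card (ι × Bool → K) * (P * R)) := by
    calc (2 : ℝ) ^ Fintype.card ι * ∑ Z, G Z
        = ∑ _σ : ι → Bool, ∑ Z, G Z := by simp
      _ = ∑ Z, ∑ v ∈ F.image fun f => f ∘ Z, ∑ σ : ι → Bool, φ (v ∘ swapPerm σ) := by
          rw [Finset.sum_congr rfl fun σ _ => hswap σ, Finset.sum_comm]
          exact Finset.sum_congr rfl fun Z _ => Finset.sum_comm
      _ ≤ ∑ _Z : ι × Bool → K, P * (2 ^ Fintype.card ι * R) := by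
          refine Finset.sum_le_sum fun Z _ => ?_
          refine (Finset.sum_le_sum (hv Z)).trans ?_
          rw [Finset.sum_const, nsmul_eq_mul]
          gcongr
          exact hP Z
      _ = _ := by
          rw [Finset.sum_const, nsmul_eq_mul, Finset.card_univ]
          ring
  exact le_of_mul_le_mul_left key (by positivity)

theorem sum_mul_eq_sum_mul_average {β : Type*} [Fintype β] {c f : β → ℝ} {D : Finset β}
    (h0 : ∀ b ∉ D, c b = 0) (hc : ∀ b ∈ D, ∀ b' ∈ D, c b = c b') :
    ∑ b, c b * f b = (∑ b, c b) * ((D.card : ℝ)⁻¹ * ∑ b ∈ D, f b) := by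
  have h1 : ∑ b, c b * f b = ∑ b ∈ D, c b * f b :=
    (Finset.sum_subset (Finset.subset_univ D) fun b _ hb => by rw [h0 b hb, zero_mul]).symm
  have h2 : ∑ b, c b = ∑ b ∈ D, c b :=
    (Finset.sum_subset (Finset.subset_univ D) fun b _ hb => h0 b hb).symm
  rw [h1, h2]
  rcases D.eq_empty_or_nonempty with rfl | ⟨b₀, hb₀⟩
  · simp
  · have hD : (D.card : ℝ) ≠ 0 := by exact_mod_cast (Finset.card_pos.2 ⟨b₀, hb₀⟩).ne'
    rw [Finset.sum_congr rfl fun b hb => by rw [hc b hb b₀ hb₀],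
      Finset.sum_congr (g := fun _ => c b₀) rfl fun b hb => hc b hb b₀ hb₀, ← Finset.mul_sum,
      Finset.sum_const, nsmul_eq_mul]
    field_simp

section Coupling

variable {α ι : Type*} [Fintype α] [DecidableEq α] [Fintype ι]

/-- The probability of `C` when a size-`n` set containing every `S i` is chosen uniformly. -/
noncomputable def extensionWeight (n : ℕ) (S : ι → Finset α) (C : Finset α) : ℝ :=
  if ∀ i, S i ⊆ C then
    (((Finset.univ.powersetCard n).filter fun D => ∀ i, S i ⊆ D).card : ℝ)⁻¹ else 0

theorem extensionWeight_nonneg (n : ℕ) (S : ι → Finset α) (C : Finset α) :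
    0 ≤ extensionWeight n S C := by
  unfold extensionWeight
  split_ifs <;> positivity

theorem subset_of_extensionWeight_ne_zero {n : ℕ} {S : ι → Finset α} {C : Finset α}
    (h : extensionWeight n S C ≠ 0) (i : ι) : S i ⊆ C := by
  unfold extensionWeight at h
  exact (ite_ne_right_iff.1 h).1 i

theorem extensionWeight_map (n : ℕ) (S : ι → Finset α) (C : Finset α) (π : Equiv.Perm α) :
    extensionWeight n (fun i => (S i).map π.toEmbedding) (C.map π.toEmbedding) =
      extensionWeight n S C := by
  unfold extensionWeight
  simp only [Finset.map_subset_map]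
  have : ((Finset.univ.powersetCard n).filter fun D => ∀ i, (S i).map π.toEmbedding ⊆ D).card =
      ((Finset.univ.powersetCard n).filter fun D => ∀ i, S i ⊆ D).card := by
    refine (Finset.card_equiv π.finsetCongr fun D => ?_).symm
    simp [Finset.mem_powersetCard]
  rw [this]

theorem sum_extensionWeight {n : ℕ} (hn : n ≤ Fintype.card α) {S : ι → Finset α}
    (hS : ∑ i, (S i).card ≤ n) :
    ∑ C ∈ Finset.univ.powersetCard n, extensionWeight n S C = 1 := by
  obtain ⟨D, hSD, -, hD⟩ := Finset.exists_subsuperset_card_eq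
    (Finset.subset_univ (Finset.univ.biUnion S)) (Finset.card_biUnion_le.trans hS) hn
  have hpos : 0 < ((Finset.univ.powersetCard n).filter fun D => ∀ i, S i ⊆ D).card := by
    refine Finset.card_pos.2 ⟨D, Finset.mem_filter.2 ⟨?_, fun i => ?_⟩⟩
    · exact Finset.mem_powersetCard.2 ⟨Finset.subset_univ D, hD⟩
    · exact (Finset.subset_biUnion_of_mem S (Finset.mem_univ i)).trans hSD
  unfold extensionWeight
  rw [← Finset.sum_filter, Finset.sum_const, nsmul_eq_mul]
  exact mul_inv_cancel₀ (by exact_mod_cast hpos.ne')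

/-- The permutation of the size-`k` subsets induced by a permutation of the points. -/
def permSubsets (k : ℕ) (π : Equiv.Perm α) : Equiv.Perm {T : Finset α // T.card = k} :=
  π.finsetCongr.subtypeEquiv fun T => by simp

variable {n k : ℕ}

theorem sum_extensionWeight_map_mul [DecidableEq ι] (C : Finset α) (π : Equiv.Perm α)
    (F : (ι × Bool → {T : Finset α // T.card = k}) → ℝ) :
    ∑ Z : ι × Bool → {T : Finset α // T.card = k},
        extensionWeight n (fun i => (Z (i, false)).1) (C.map π.toEmbedding) * F Z =
      ∑ Z : ι × Bool → {T : Finset α // T.card = k},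
        extensionWeight n (fun i => (Z (i, false)).1) C * F fun j => permSubsets k π (Z j) := by
  rw [← ((Equiv.refl (ι × Bool)).arrowCongr (permSubsets k π)).sum_comp]
  refine Finset.sum_congr rfl fun Z _ => ?_
  rw [← extensionWeight_map n _ C π]
  rfl

theorem card_mul_sum_extensionWeight [DecidableEq ι] (hn : n ≤ Fintype.card α)
    (hk : Fintype.card ι * k ≤ n) {C : Finset α} (hC : C.card = n) :
    ((Fintype.card α).choose n : ℝ) * ∑ Z : ι × Bool → {T : Finset α // T.card = k},
        extensionWeight n (fun i => (Z (i, false)).1) C =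
      Fintype.card (ι × Bool → {T : Finset α // T.card = k}) := by
  have hconst : ∀ D ∈ (Finset.univ : Finset α).powersetCard n,
      ∑ Z : ι × Bool → {T : Finset α // T.card = k},
        extensionWeight n (fun i => (Z (i, false)).1) D =
      ∑ Z : ι × Bool → {T : Finset α // T.card = k},
        extensionWeight n (fun i => (Z (i, false)).1) C := by
    intro D hD
    obtain ⟨π, -, rfl⟩ := exists_perm_map_eq (Finset.empty_subset C) (Finset.empty_subset D) rfl
      (hC.trans (Finset.mem_powersetCard.1 hD).2.symm)
    simpa using sum_extensionWeight_map_mul (n := n) (k := k) (ι := ι) C π fun _ => 1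
  rw [← Finset.card_univ (α := α), ← Finset.card_powersetCard, ← nsmul_eq_mul, ← Finset.sum_const,
    ← Finset.sum_congr rfl hconst, Finset.sum_comm]
  rw [Finset.sum_congr rfl fun Z _ => sum_extensionWeight hn ?_]
  · simp
  · simpa [fun i => (Z (i, false)).2] using hk

theorem sum_extensionWeight_mul_false [DecidableEq ι] (C : Finset α) (f : Finset α → ℝ) (i : ι) :
    ∑ Z : ι × Bool → {T : Finset α // T.card = k},
        extensionWeight n (fun i => (Z (i, false)).1) C * f (Z (i, false)).1 =
      (∑ Z : ι × Bool → {T : Finset α // T.card = k},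
        extensionWeight n (fun i => (Z (i, false)).1) C) * Qk k C f := by
  set c : Finset α → ℝ := fun T => ∑ Z : ι × Bool → {T : Finset α // T.card = k},
    extensionWeight n (fun i => (Z (i, false)).1) C * if (Z (i, false)).1 = T then 1 else 0 with hc
  have hsum : ∀ g : Finset α → ℝ, ∑ T, c T * g T = ∑ Z : ι × Bool → {T : Finset α // T.card = k},
      extensionWeight n (fun i => (Z (i, false)).1) C * g (Z (i, false)).1 := by
    intro g
    simp only [hc, Finset.sum_mul]
    rw [Finset.sum_comm]
    exact Finset.sum_congr rfl fun Z _ => by simp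
  have h := sum_mul_eq_sum_mul_average (c := c) (f := f) (D := C.powersetCard k) ?_ ?_
  · have h1 := hsum fun _ => 1
    simp only [mul_one] at h1
    rw [← hsum, h, h1, Qk, Finset.card_powersetCard]
  · intro T hT
    refine Finset.sum_eq_zero fun Z _ => ?_
    by_contra hne
    have h1 := left_ne_zero_of_mul hne
    have h2 : (Z (i, false)).1 = T := by simpa using right_ne_zero_of_mul hne
    refine hT (Finset.mem_powersetCard.2 ⟨?_, ?_⟩)
    · exact h2 ▸ subset_of_extensionWeight_ne_zero h1 i
    · exact h2 ▸ (Z (i, false)).2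
  · intro T hT T' hT'
    rw [Finset.mem_powersetCard] at hT hT'
    obtain ⟨π, hπT, hπC⟩ := exists_perm_map_eq hT.1 hT'.1 (hT.2.trans hT'.2.symm) rfl
    have h := sum_extensionWeight_map_mul (n := n) (k := k) (ι := ι) C π
      fun Z => if (Z (i, false)).1 = T' then 1 else 0
    rw [hπC] at h
    simp only [hc, h]
    refine Finset.sum_congr rfl fun Z _ => ?_
    congr 1
    refine if_congr ?_ rfl rfl
    rw [← hπT]
    exact (Finset.map_injective π.toEmbedding).eq_iff.symm

theorem sum_extensionWeight_mul_true [DecidableEq ι] (C : Finset α) (f : Finset α → ℝ) (i : ι) :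
    ∑ Z : ι × Bool → {T : Finset α // T.card = k},
        extensionWeight n (fun i => (Z (i, false)).1) C * f (Z (i, true)).1 =
      (∑ Z : ι × Bool → {T : Finset α // T.card = k},
        extensionWeight n (fun i => (Z (i, false)).1) C) * Qk k Finset.univ f := by
  set c : Finset α → ℝ := fun T => ∑ Z : ι × Bool → {T : Finset α // T.card = k},
    extensionWeight n (fun i => (Z (i, false)).1) C * if (Z (i, true)).1 = T then 1 else 0 with hc
  have hsum : ∀ g : Finset α → ℝ, ∑ T, c T * g T = ∑ Z : ι × Bool → {T : Finset α // T.card = k},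
      extensionWeight n (fun i => (Z (i, false)).1) C * g (Z (i, true)).1 := by
    intro g
    simp only [hc, Finset.sum_mul]
    rw [Finset.sum_comm]
    exact Finset.sum_congr rfl fun Z _ => by simp
  have h := sum_mul_eq_sum_mul_average (c := c) (f := f) (D := Finset.univ.powersetCard k) ?_ ?_
  · have h1 := hsum fun _ => 1
    simp only [mul_one] at h1
    rw [← hsum, h, h1, Qk, Finset.card_powersetCard]
  · intro T hT
    refine Finset.sum_eq_zero fun Z _ => ?_
    by_contra hne
    have h2 : (Z (i, true)).1 = T := by simpa using right_ne_zero_of_mul hne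
    exact hT (Finset.mem_powersetCard.2 ⟨Finset.subset_univ T, h2 ▸ (Z (i, true)).2⟩)
  · intro T hT T' hT'
    rw [Finset.mem_powersetCard] at hT hT'
    let τ : Equiv.Perm {T : Finset α // T.card = k} := Equiv.swap ⟨T, hT.2⟩ ⟨T', hT'.2⟩
    simp only [hc]
    rw [← (Equiv.piCongrRight fun j : ι × Bool =>
      if j = (i, true) then τ else Equiv.refl _).sum_comp]
    refine Finset.sum_congr rfl fun Z _ => ?_
    simp only [Equiv.piCongrRight_apply, Pi.map_apply, Prod.mk.injEq, Bool.false_eq_true, and_false,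
      if_false, Equiv.refl_apply, if_true]
    congr 1
    refine if_congr ?_ rfl rfl
    have h1 : (τ (Z (i, true))).1 = T ↔ τ (Z (i, true)) = ⟨T, hT.2⟩ :=
      (Subtype.ext_iff (a2 := ⟨T, hT.2⟩)).symm
    have h2 : (Z (i, true)).1 = T' ↔ Z (i, true) = ⟨T', hT'.2⟩ :=
      (Subtype.ext_iff (a2 := ⟨T', hT'.2⟩)).symm
    rw [h1, h2, ← Equiv.eq_symm_apply]
    simp [τ]

theorem sum_extensionWeight_mul_exp_le [DecidableEq ι] (C : Finset α) (f : Finset α → ℝ)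
    (c : ℝ) :
    (∑ Z : ι × Bool → {T : Finset α // T.card = k},
        extensionWeight n (fun i => (Z (i, false)).1) C) *
        Real.exp (c * (Fintype.card ι * (Qk k Finset.univ f - Qk k C f))) ≤
      ∑ Z : ι × Bool → {T : Finset α // T.card = k},
        extensionWeight n (fun i => (Z (i, false)).1) C *
          Real.exp (c * ∑ i, (f (Z (i, true)).1 - f (Z (i, false)).1)) := by
  set w : (ι × Bool → {T : Finset α // T.card = k}) → ℝ :=
    fun Z => extensionWeight n (fun i => (Z (i, false)).1) C with hw
  set y : (ι × Bool → {T : Finset α // T.card = k}) → ℝ :=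
    fun Z => c * ∑ i, (f (Z (i, true)).1 - f (Z (i, false)).1) with hy
  set x : ℝ := c * (Fintype.card ι * (Qk k Finset.univ f - Qk k C f)) with hx
  have hmean : ∑ Z, w Z * y Z = (∑ Z, w Z) * x := by
    calc ∑ Z, w Z * y Z
        = c * ∑ i, ((∑ Z, w Z * f (Z (i, true)).1) - ∑ Z, w Z * f (Z (i, false)).1) := by
          simp_rw [← Finset.sum_sub_distrib, ← mul_sub]
          rw [Finset.sum_comm, Finset.mul_sum]
          refine Finset.sum_congr rfl fun Z _ => ?_
          rw [← Finset.mul_sum]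
          ring
      _ = (∑ Z, w Z) * x := by
          simp only [hw, sum_extensionWeight_mul_true, sum_extensionWeight_mul_false]
          rw [Finset.sum_const, nsmul_eq_mul, Finset.card_univ]
          ring
  calc (∑ Z, w Z) * Real.exp x
      = ∑ Z, w Z * (Real.exp x * (y Z - x + 1)) := by
        have : ∀ Z, w Z * (Real.exp x * (y Z - x + 1)) =
            Real.exp x * (w Z * y Z) + Real.exp x * (1 - x) * w Z := fun Z => by ring
        simp_rw [this]
        rw [Finset.sum_add_distrib, ← Finset.mul_sum, ← Finset.mul_sum, hmean]
        ring
    _ ≤ ∑ Z, w Z * Real.exp (y Z) := by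
        refine Finset.sum_le_sum fun Z _ => ?_
        refine mul_le_mul_of_nonneg_left ?_ (extensionWeight_nonneg _ _ _)
        calc Real.exp x * (y Z - x + 1) ≤ Real.exp x * Real.exp (y Z - x) := by
              gcongr
              exact Real.add_one_le_exp _
          _ = Real.exp (y Z) := by rw [← Real.exp_add, add_sub_cancel]

theorem card_deviation_le [DecidableEq ι] (hn : n ≤ Fintype.card α) (hkn : k ≤ n)
    (hι : Fintype.card ι * k ≤ n) {F : Finset (Finset α → ℝ)}
    (hF : ∀ f ∈ F, ∀ S, f S = 0 ∨ f S = 1) {P : ℝ}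
    (hP : ∀ Z : ι × Bool → {T : Finset α // T.card = k},
      ((F.image fun f j => f (Z j).1).card : ℝ) ≤ P)
    {ε : ℝ} (hε : 0 ≤ ε) {B : Finset (Finset α)} (hB : B ⊆ Finset.univ.powersetCard n)
    (hdev : ∀ C ∈ B, ∃ f ∈ F, ε ≤ |Qk k Finset.univ f - Qk k C f|) :
    (B.card : ℝ) ≤ (Fintype.card α).choose n *
      (2 * P * Real.exp (-(Fintype.card ι * ε ^ 2) / 2)) := by
  set q : ℝ := (Fintype.card ι : ℝ) with hq
  set M : ℝ := (Fintype.card (ι × Bool → {T : Finset α // T.card = k}) : ℝ) with hM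
  set b : ℝ := ((Fintype.card α).choose n : ℝ) with hb
  let V := fun Z : ι × Bool → {T : Finset α // T.card = k} => F.image fun f j => f (Z j).1
  let G := fun (c : ℝ) Z => ∑ v ∈ V Z, Real.exp (c * ∑ i, (v (i, true) - v (i, false)))
  have hMpos : 0 < M := by
    obtain ⟨T, -, hT⟩ := Finset.exists_subset_card_eq (hkn.trans hn)
    have : Nonempty {T : Finset α // T.card = k} := ⟨⟨T, hT⟩⟩
    exact Nat.cast_pos.2 Fintype.card_pos
  have hG : ∀ c, ∑ Z, G c Z ≤ M * (P * Real.exp (c ^ 2 * q / 2)) := by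
    intro c
    have himage : ∀ Z : ι × Bool → {T : Finset α // T.card = k},
        ((F.image fun f (T : {T : Finset α // T.card = k}) => f T.1).image fun g => g ∘ Z) =
          V Z := by
      intro Z
      rw [Finset.image_image]
      rfl
    have h := sum_image_exp_le (ι := ι)
      (F := F.image fun f (T : {T : Finset α // T.card = k}) => f T.1) (P := P) ?_ ?_ c
    · simpa only [himage] using h
    · intro g hg T
      obtain ⟨f, hf, rfl⟩ := Finset.mem_image.1 hg
      exact hF f hf T.1
    · intro Z
      rw [himage]
      exact hP Z
  have hC : ∀ C ∈ B, M * Real.exp (q * ε ^ 2) ≤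
      b * ∑ Z, extensionWeight n (fun i => (Z (i, false)).1) C * (G ε Z + G (-ε) Z) := by
    intro C hCB
    obtain ⟨f, hf, hfε⟩ := hdev C hCB
    rw [hM, ← card_mul_sum_extensionWeight hn hι (Finset.mem_powersetCard.1 (hB hCB)).2, mul_assoc]
    refine mul_le_mul_of_nonneg_left ?_ (by positivity)
    set x := Qk k Finset.univ f - Qk k C f
    have hexp : Real.exp (q * ε ^ 2) ≤ Real.exp (ε * (q * x)) + Real.exp (-ε * (q * x)) := by
      have hqε : 0 ≤ q * ε := by positivity
      rcases le_abs.1 hfε with h | h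
      · refine le_add_of_le_of_nonneg (Real.exp_le_exp.2 ?_) (Real.exp_pos _).le
        nlinarith [mul_le_mul_of_nonneg_left h hqε]
      · refine le_add_of_nonneg_of_le (Real.exp_pos _).le (Real.exp_le_exp.2 ?_)
        nlinarith [mul_le_mul_of_nonneg_left h hqε]
    have hexpG : ∀ c Z, Real.exp (c * ∑ i, (f (Z (i, true)).1 - f (Z (i, false)).1)) ≤ G c Z :=
      fun c Z => Finset.single_le_sum
        (f := fun v : ι × Bool → ℝ => Real.exp (c * ∑ i, (v (i, true) - v (i, false))))
        (fun v _ => (Real.exp_pos _).le)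
        (Finset.mem_image_of_mem (fun f (j : ι × Bool) => f (Z j).1) hf)
    refine (mul_le_mul_of_nonneg_left hexp
      (Finset.sum_nonneg fun Z _ => extensionWeight_nonneg _ _ _)).trans ?_
    rw [mul_add]
    refine (add_le_add (sum_extensionWeight_mul_exp_le C f ε)
      (sum_extensionWeight_mul_exp_le C f (-ε))).trans ?_
    rw [← Finset.sum_add_distrib]
    refine Finset.sum_le_sum fun Z _ => ?_
    rw [← mul_add]
    exact mul_le_mul_of_nonneg_left (add_le_add (hexpG ε Z) (hexpG (-ε) Z))
      (extensionWeight_nonneg _ _ _)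
  have hG0 : ∀ c Z, 0 ≤ G c Z := fun c Z => Finset.sum_nonneg fun v _ => (Real.exp_pos _).le
  have hsum : B.card * (M * Real.exp (q * ε ^ 2)) ≤
      b * (M * (2 * P * Real.exp (ε ^ 2 * q / 2))) := by
    calc B.card * (M * Real.exp (q * ε ^ 2))
        = ∑ _C ∈ B, M * Real.exp (q * ε ^ 2) := by rw [Finset.sum_const, nsmul_eq_mul]
      _ ≤ ∑ C ∈ B, b * ∑ Z, extensionWeight n (fun i => (Z (i, false)).1) C *
            (G ε Z + G (-ε) Z) := Finset.sum_le_sum hC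
      _ ≤ ∑ C ∈ Finset.univ.powersetCard n, b * ∑ Z,
            extensionWeight n (fun i => (Z (i, false)).1) C * (G ε Z + G (-ε) Z) := by
          refine Finset.sum_le_sum_of_subset_of_nonneg hB fun C _ _ => ?_
          refine mul_nonneg (by positivity) (Finset.sum_nonneg fun Z _ => ?_)
          exact mul_nonneg (extensionWeight_nonneg _ _ _) (add_nonneg (hG0 _ _) (hG0 _ _))
      _ = b * (∑ Z, G ε Z + ∑ Z, G (-ε) Z) := by
          rw [← Finset.mul_sum, Finset.sum_comm, ← Finset.sum_add_distrib]
          congr 1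
          refine Finset.sum_congr rfl fun Z _ => ?_
          rw [← Finset.sum_mul, sum_extensionWeight hn, one_mul]
          simpa [fun i => (Z (i, false)).2] using hι
      _ ≤ b * (M * (P * Real.exp (ε ^ 2 * q / 2)) + M * (P * Real.exp ((-ε) ^ 2 * q / 2))) := by
          gcongr
          · exact hG ε
          · exact hG (-ε)
      _ = _ := by
          rw [neg_sq]
          ring
  have hsplit : Real.exp (ε ^ 2 * q / 2) =
      Real.exp (-(q * ε ^ 2) / 2) * Real.exp (q * ε ^ 2) := by
    rw [← Real.exp_add]
    congr 1
    ring
  rw [hsplit] at hsum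
  refine le_of_mul_le_mul_right (hsum.trans_eq' ?_ |>.trans_eq ?_)
    (mul_pos hMpos (Real.exp_pos (q * ε ^ 2)))
  · rfl
  · ring

end Coupling

theorem le_exp_add_sqrt_mul_exp {x P p : ℝ} (hx : 0 ≤ x) (hP : 1 ≤ P) (hp : p ≤ 1)
    (hpP : p ≤ 2 * P * Real.exp (-x / 2)) :
    p ≤ Real.exp (-x / 4) + √(8 * Real.pi * x) * P * Real.exp (-x / 8) := by
  have hπ := Real.pi_gt_three
  rcases le_total 4 (8 * Real.pi * x) with h | h
  · have hsqrt : 2 ≤ √(8 * Real.pi * x) := Real.le_sqrt_of_sq_le (by linarith)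
    refine hpP.trans (le_add_of_nonneg_of_le (Real.exp_pos _).le ?_)
    gcongr ?_ * _ * Real.exp ?_
    linarith
  · have hx1 : x ≤ 1 / 6 := by nlinarith
    have hsqrt : x ≤ √(8 * Real.pi * x) := Real.le_sqrt_of_sq_le (by nlinarith)
    have h1 := Real.add_one_le_exp (-x / 4)
    have h2 : 1 / 2 ≤ Real.exp (-x / 8) := by linarith [Real.add_one_le_exp (-x / 8)]
    have h3 : x * 1 * (1 / 2) ≤ √(8 * Real.pi * x) * P * Real.exp (-x / 8) := by gcongr
    linarith

theorem card_image_restrict_le {α κ : Type*} [DecidableEq α] [Fintype κ] [DecidableEq κ]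
    {k d : ℕ} {H : Set (Finset α → ℝ)} (hbool : ∀ f ∈ H, ∀ S : Finset α, f S = 0 ∨ f S = 1)
    (hVC : VCDimEq k H d) {F : Finset (Finset α → ℝ)} (hF : ∀ f, f ∈ F ↔ f ∈ H)
    (Z : κ → {T : Finset α // T.card = k}) :
    (F.image fun f j => f (Z j).1).card ≤ ∑ i ∈ Finset.Iic d, (Fintype.card κ).choose i := by
  have h := card_image_comp_le (κ := κ) (d := d)
    (F := F.image fun f (T : {T : Finset α // T.card = k}) => f T.1) ?_ ?_ Z
  · rw [Finset.image_image] at h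
    exact h
  · intro g hg T
    obtain ⟨f, hf, rfl⟩ := Finset.mem_image.1 hg
    exact hbool f ((hF f).1 hf) T.1
  · intro X hX
    rw [← Finset.card_map (Function.Embedding.subtype fun T : Finset α => T.card = k)]
    refine hVC.2 ⟨_, ⟨fun S hS => ?_, fun Y hY => ?_⟩, rfl⟩
    · obtain ⟨T, -, rfl⟩ := Finset.mem_map.1 hS
      exact T.2
    · obtain ⟨g, hg, hg1, hg0⟩ := hX (X.filter fun T => T.1 ∈ Y) (Finset.filter_subset _ _)
      obtain ⟨f, hf, rfl⟩ := Finset.mem_image.1 hg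
      refine ⟨f, (hF f).1 hf, fun S hS => ?_, fun S hS => ?_⟩
      · obtain ⟨T, hT, rfl⟩ := Finset.mem_map.1 (hY hS)
        exact hg1 T (Finset.mem_filter.2 ⟨hT, hS⟩)
      · obtain ⟨hS1, hS2⟩ := Finset.mem_sdiff.1 hS
        obtain ⟨T, hT, rfl⟩ := Finset.mem_map.1 hS1
        exact hg0 T (Finset.mem_sdiff.2 ⟨hT, fun h => hS2 (Finset.mem_filter.1 h).2⟩)

/-- Theorem 2 of the paper: tail bound for `sup_{f ∈ H} |Q_k(univ, f) − Q_k(C, f)|` where `C` is a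
uniformly random size-`n` subset of `α`, in terms of the VC dimension `d` of `H` and `m = ⌊n/k⌋`. -/
theorem stmt1 {α : Type*} [Fintype α] [DecidableEq α] (N k n d : ℕ)
    (hN : Fintype.card α = N) (hk : 1 ≤ k) (hkn : k ≤ n) (hnN : n ≤ N)
    (H : Set (Finset α → ℝ)) (hH : H.Nonempty)
    (hbool : ∀ f ∈ H, ∀ S : Finset α, f S = 0 ∨ f S = 1)
    (hd : 1 ≤ d) (hdm : d ≤ n / k)
    (hVC : VCDimEq k H d) (ε : ℝ) (hε0 : 0 < ε) (hε1 : ε ≤ 1) :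
    (N.choose n : ℝ)⁻¹ *
        (((Finset.univ : Finset α).powersetCard n).filter
            (fun C => ε ≤ ⨆ f : H, |Qk k Finset.univ f.1 - Qk k C f.1|)).card ≤
      Real.exp (-((n / k : ℕ) * ε ^ 2) / 4) +
        ε * Real.sqrt (8 * Real.pi * (n / k : ℕ)) *
            (2 * Real.exp 1 * (n / k : ℕ) / d) ^ d *
          Real.exp (-((n / k : ℕ) * ε ^ 2) / 8) := by
  subst hN
  set m := n / k with hm
  have hfin : H.Finite :=
    (Set.Finite.pi' fun _ : Finset α => Set.toFinite ({0, 1} : Set ℝ)).subset hbool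
  have hF : ∀ f, f ∈ hfin.toFinset ↔ f ∈ H := fun f => hfin.mem_toFinset
  have hm1 : 1 ≤ m := hd.trans hdm
  have hm0 : (0 : ℝ) < m := by exact_mod_cast hm1
  have hd0 : (0 : ℝ) < d := by exact_mod_cast hd
  set P : ℝ := (2 * Real.exp 1 * m / d) ^ d with hPdef
  have hP1 : 1 ≤ P := by
    refine one_le_pow₀ ((one_le_div hd0).2 ?_)
    have h1 : (d : ℝ) ≤ m := by exact_mod_cast hdm
    have h2 : 1 ≤ Real.exp 1 := Real.one_le_exp zero_le_one
    nlinarith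
  have hP : ∀ Z : Fin m × Bool → {T : Finset α // T.card = k},
      ((hfin.toFinset.image fun f j => f (Z j).1).card : ℝ) ≤ P := by
    intro Z
    have h1 : ((hfin.toFinset.image fun f j => f (Z j).1).card : ℝ) ≤
        ∑ i ∈ Finset.Iic d, ((Fintype.card (Fin m × Bool)).choose i : ℝ) := by
      exact_mod_cast card_image_restrict_le hbool hVC hF Z
    refine h1.trans ((sum_choose_le_exp_mul_div_pow hd ?_).trans_eq ?_)
    · simp
      omega
    · rw [hPdef]
      congr 2
      simp
      ring
  set B := ((Finset.univ : Finset α).powersetCard n).filter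
    (fun C => ε ≤ ⨆ f : H, |Qk k Finset.univ f.1 - Qk k C f.1|) with hB
  have hBsub : B ⊆ Finset.univ.powersetCard n := Finset.filter_subset _ _
  have hdev : ∀ C ∈ B, ∃ f ∈ hfin.toFinset, ε ≤ |Qk k Finset.univ f - Qk k C f| := by
    intro C hC
    have : Finite H := hfin
    have : Nonempty H := hH.to_subtype
    obtain ⟨f, hf⟩ := exists_eq_ciSup_of_finite
      (f := fun f : H => |Qk k Finset.univ f.1 - Qk k C f.1|)
    exact ⟨f.1, (hF _).2 f.2, hf ▸ (Finset.mem_filter.1 hC).2⟩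
  have hb : (0 : ℝ) < (Fintype.card α).choose n := by exact_mod_cast Nat.choose_pos hnN
  have htail := card_deviation_le (ι := Fin m) hnN hkn
    (by simpa using Nat.div_mul_le_self n k) (fun f hf => hbool f ((hF f).1 hf)) hP hε0.le hBsub hdev
  have hcard : (B.card : ℝ) ≤ (Fintype.card α).choose n := by
    have := Finset.card_le_card hBsub
    rw [Finset.card_powersetCard, Finset.card_univ] at this
    exact_mod_cast this
  rw [Fintype.card_fin] at htail
  have hsqrt : ε * √(8 * Real.pi * m) = √(8 * Real.pi * (m * ε ^ 2)) := by
    rw [← mul_assoc, Real.sqrt_mul (by positivity) (ε ^ 2), Real.sqrt_sq hε0.le, mul_comm]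
  rw [hsqrt]
  refine le_exp_add_sqrt_mul_exp (by positivity) hP1 ?_ ?_
  · exact (inv_mul_le_one₀ hb).2 hcard
  · exact (inv_mul_le_iff₀ hb).2 htail
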